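/- For real c < 0, let s*(c) < 0 be the solution of s e^{-s} = c. Then s ↦ F(s, c) = ∫₀^s du/(c e^u − u) is strictly decreasing on (s*(c), ∞), with F(s, c) → +∞ as s → s*(c)+ and F(s, c) → H(c) < 0 as s → ∞. -/

import Mathlib

open MeasureTheory Real Filter

/-- For `c < 0`, with `s* < 0` the solution of `s e^{-s} = c`:
`s ↦ F(s,c) = ∫₀^s du/(c e^u − u)` is strictly decreasing on `(s*, ∞)`, tends to
`+∞` as `s → s*+`, and tends to `H(c) < 0` as `s → ∞`. -/
theorem F_left_branch (c sstar : ℝ) (hc : c < 0) (hstarneg : sstar < 0)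
    (hstar : sstar * Real.exp (-sstar) = c) :
    StrictAntiOn (fun s : ℝ => ∫ u in (0:ℝ)..s, (c * Real.exp u - u)⁻¹)
      (Set.Ioi sstar) ∧
    Tendsto (fun s : ℝ => ∫ u in (0:ℝ)..s, (c * Real.exp u - u)⁻¹)
      (nhdsWithin sstar (Set.Ioi sstar)) atTop ∧
    Tendsto (fun s : ℝ => ∫ u in (0:ℝ)..s, (c * Real.exp u - u)⁻¹) atTop
      (nhds (∫ u in Set.Ioi (0:ℝ), (c * Real.exp u - u)⁻¹)) ∧
    (∫ u in Set.Ioi (0:ℝ), (c * Real.exp u - u)⁻¹) < 0 := by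
  have hg : ∀ u, sstar < u → c * Real.exp u - u < 0 := by
    intro u hu
    have h1 : c * Real.exp u = sstar * Real.exp (u - sstar) := by
      rw [← hstar, mul_assoc, ← Real.exp_add]; congr 2; ring
    have h2 : 1 < Real.exp (u - sstar) := Real.one_lt_exp_iff.2 (by linarith)
    rw [h1]
    nlinarith
  have hcont : ContinuousOn (fun u : ℝ => (c * Real.exp u - u)⁻¹) (Set.Ioi sstar) := by
    apply ContinuousOn.inv₀ (by fun_prop)
    intro u hu
    exact (hg u hu).ne
  have hInteg : ∀ a b, sstar < a → sstar < b →
      IntervalIntegrable (fun u : ℝ => (c * Real.exp u - u)⁻¹) volume a b := by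
    intro a b ha hb
    apply ContinuousOn.intervalIntegrable
    apply hcont.mono
    intro x hx
    exact lt_of_lt_of_le (lt_min ha hb) hx.1
  have hanti : StrictAntiOn (fun s : ℝ => ∫ u in (0:ℝ)..s, (c * Real.exp u - u)⁻¹)
      (Set.Ioi sstar) := by
    intro a ha b hb hab
    have h1 := intervalIntegral.integral_interval_sub_left (hInteg 0 b hstarneg hb)
      (hInteg 0 a hstarneg ha)
    have h2 : 0 < ∫ u in a..b, -(c * Real.exp u - u)⁻¹ := by
      apply intervalIntegral.intervalIntegral_pos_of_pos_on (hInteg a b ha hb).neg _ hab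
      intro x hx
      have := inv_lt_zero.2 (hg x (lt_trans ha hx.1))
      exact neg_pos.2 this
    rw [intervalIntegral.integral_neg] at h2
    show (∫ u in (0:ℝ)..b, (c * Real.exp u - u)⁻¹) < ∫ u in (0:ℝ)..a, (c * Real.exp u - u)⁻¹
    linarith
  have hIntOn : IntegrableOn (fun u : ℝ => (c * Real.exp u - u)⁻¹) (Set.Ioi 0) := by
    have h0 : IntegrableOn (fun u : ℝ => (-c)⁻¹ * Real.exp (-u)) (Set.Ioi 0) :=
      (integrableOn_exp_neg_Ioi 0).const_mul _
    refine Integrable.mono' h0 ?_ ?_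
    · exact (hcont.mono (Set.Ioi_subset_Ioi hstarneg.le)).aestronglyMeasurable measurableSet_Ioi
    · refine (ae_restrict_iff' measurableSet_Ioi).2 (Eventually.of_forall ?_)
      intro u hu
      have hu' : 0 < u := hu
      have he := Real.exp_pos u
      rw [Real.exp_neg, ← mul_inv, norm_inv, Real.norm_eq_abs, abs_of_neg (hg u (by linarith))]
      apply inv_anti₀ <;> nlinarith
  have hlim := intervalIntegral_tendsto_integral_Ioi (0:ℝ) hIntOn tendsto_id
  refine ⟨hanti, ?_, hlim, ?_⟩
  · have hK : 0 < 1 - c := by linarith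
    have hlog : Tendsto (fun s : ℝ => (1 - c)⁻¹ * (Real.log (-sstar) - Real.log (s - sstar)))
        (nhdsWithin sstar (Set.Ioi sstar)) atTop := by
      apply Tendsto.const_mul_atTop (inv_pos.2 hK)
      have h1 : Tendsto (fun s : ℝ => s - sstar) (nhdsWithin sstar (Set.Ioi sstar))
          (nhdsWithin 0 (Set.Ioi 0)) := by
        apply tendsto_nhdsWithin_iff.2 ⟨_, _⟩
        · apply Tendsto.mono_left _ nhdsWithin_le_nhds
          have : Continuous (fun s : ℝ => s - sstar) := by fun_prop
          simpa using this.tendsto sstar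
        · filter_upwards [self_mem_nhdsWithin] with s hs
          exact sub_pos.2 (show sstar < s from hs)
      have h2 := tendsto_neg_atBot_atTop.comp (Real.tendsto_log_nhdsGT_zero.comp h1)
      exact tendsto_atTop_add_const_left _ (Real.log (-sstar)) h2
    refine tendsto_atTop_mono' _ ?_ hlog
    have hmem : Set.Iio (0:ℝ) ∈ nhdsWithin sstar (Set.Ioi sstar) :=
      mem_nhdsWithin_of_mem_nhds (Iio_mem_nhds hstarneg)
    filter_upwards [self_mem_nhdsWithin, hmem] with s hs hs0
    have hs' : sstar < s := hs
    have hs0' : s < 0 := hs0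
    have hne : ∀ x ∈ Set.uIcc s 0, x - sstar ≠ 0 := by
      intro x hx
      rw [Set.uIcc_of_le hs0'.le] at hx
      have := hx.1
      exact (by linarith : 0 < x - sstar).ne'
    have hI : (∫ u in s..0, (u - sstar)⁻¹) = Real.log (-sstar) - Real.log (s - sstar) := by
      rw [intervalIntegral.integral_comp_sub_right (fun x : ℝ => x⁻¹) sstar,
        integral_inv_of_pos (by linarith) (by linarith),
        Real.log_div (by linarith) (by linarith), zero_sub]
    rw [← hI, intervalIntegral.integral_symm s 0, ← intervalIntegral.integral_neg,
      ← intervalIntegral.integral_const_mul]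
    apply intervalIntegral.integral_mono_on hs0'.le
    · apply ContinuousOn.intervalIntegrable
      exact continuousOn_const.mul (ContinuousOn.inv₀ (by fun_prop) hne)
    · exact (hInteg s 0 hs' hstarneg).neg
    · intro u hu
      have hu1 : sstar < u := lt_of_lt_of_le hs' hu.1
      have hu2 : u ≤ 0 := hu.2
      rw [← mul_inv, ← inv_neg]
      apply inv_anti₀
      · linarith [hg u hu1]
      · skip
        have h1 : sstar = c * Real.exp sstar := by
          rw [← hstar, mul_assoc, ← Real.exp_add]; simp
        have h2 : Real.exp sstar = Real.exp u * Real.exp (sstar - u) := by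
          rw [← Real.exp_add]; congr 1; ring
        have h3 := Real.add_one_le_exp (sstar - u)
        have h4 : Real.exp u ≤ 1 := Real.exp_le_one_iff.2 hu2
        have h5 := Real.exp_pos u
        have h6 : Real.exp u - Real.exp sstar ≤ u - sstar := by
          rw [h2]
          nlinarith
        nlinarith
  · have h1 : (∫ u in (0:ℝ)..1, (c * Real.exp u - u)⁻¹) < 0 := by
      have := hanti (show (0:ℝ) ∈ Set.Ioi sstar from hstarneg)
        (show (1:ℝ) ∈ Set.Ioi sstar from by simp only [Set.mem_Ioi]; linarith) zero_lt_one
      simpa using this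
    refine lt_of_le_of_lt ?_ h1
    apply le_of_tendsto hlim
    filter_upwards [eventually_ge_atTop (1:ℝ)] with s hs
    exact hanti.antitoneOn (show (1:ℝ) ∈ Set.Ioi sstar from by simp only [Set.mem_Ioi]; linarith)
      (show s ∈ Set.Ioi sstar from by simp only [Set.mem_Ioi]; linarith) hs
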